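/- arXiv:2305.13881 — 4 statements merged into one kernel-verified Lean document; each statement's English description precedes it below -/
import Mathlib

section
/- If S and T are saturated numerical semigroups, then S ∩ T is a saturated numerical semigroup. -/
/-- A numerical semigroup: subset of ℕ containing 0, closed under addition,
with finite complement. -/
def IsNumericalSemigroup (S : Set ℕ) : Prop :=
  0 ∈ S ∧ (∀ a ∈ S, ∀ b ∈ S, a + b ∈ S) ∧ Sᶜ.Finite

/-- `dOf S s = gcd {x ∈ S : x ≤ s}`. -/
noncomputable def dOf (S : Set ℕ) (s : ℕ) : ℕ :=
  letI := Classical.decPred (· ∈ S)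
  ((Finset.range (s + 1)).filter (· ∈ S)).gcd id

/-- A saturated numerical semigroup. -/
def IsSaturatedNS (S : Set ℕ) : Prop :=
  IsNumericalSemigroup S ∧ ∀ s ∈ S, s ≠ 0 → s + dOf S s ∈ S

/-- `Sat F`: saturated numerical semigroups with Frobenius number `F`. -/
def SatF (F : ℕ) : Set (Set ℕ) :=
  {S | IsSaturatedNS S ∧ F ∉ S ∧ ∀ x, x ∉ S → x ≤ F}

/-- Multiplicity: least nonzero element. -/
noncomputable def multOf (S : Set ℕ) : ℕ := sInf {x | x ∈ S ∧ x ≠ 0}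

/-- Pseudo-Frobenius numbers. -/
def PFset (S : Set ℕ) : Set ℕ := {z | z ∉ S ∧ ∀ s ∈ S, s ≠ 0 → z + s ∈ S}

/-- Special gaps. -/
def SGset (S : Set ℕ) : Set ℕ := {x | x ∈ PFset S ∧ 2 * x ∈ S}

/-- `TSet a b = ⟨a⟩ ∪ {x : x ≥ b}`. -/
def TSet (a b : ℕ) : Set ℕ := {x | a ∣ x} ∪ {x | b ≤ x}

/-- A `Sat(F)`-set. -/
def SatFSet (F : ℕ) (X : Set ℕ) : Prop :=
  X ∩ ({0} ∪ {x | F + 1 ≤ x}) = ∅ ∧ ∃ S ∈ SatF F, X ⊆ S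

/-- `Sat(F)[X]`: intersection of all elements of `Sat F` containing `X`. -/
def SatClosure (F : ℕ) (X : Set ℕ) : Set ℕ := ⋂₀ {S | S ∈ SatF F ∧ X ⊆ S}

/-- `X` is a minimal `Sat(F)`-system of generators of `S`. -/
def IsMinSatGen (F : ℕ) (X S : Set ℕ) : Prop :=
  SatFSet F X ∧ SatClosure F X = S ∧ ∀ Y : Set ℕ, Y ⊂ X → SatClosure F Y ≠ S

/-- The `Sat(F)`-rank of `S`: minimal cardinality of a `Sat(F)`-set `X`
with `Sat(F)[X] = S`. -/
noncomputable def SatRank (F : ℕ) (S : Set ℕ) : ℕ :=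
  sInf {k | ∃ X : Set ℕ, SatFSet F X ∧ SatClosure F X = S ∧ X.ncard = k}

lemma dOf_dvd_of_subset {S T : Set ℕ} (h : S ⊆ T) {s t : ℕ} (hst : s ≤ t) :
    dOf T t ∣ dOf S s := by
  classical
  refine Finset.dvd_gcd fun x hx => ?_
  rw [Finset.mem_filter, Finset.mem_range] at hx
  exact Finset.gcd_dvd (f := id)
    (Finset.mem_filter.2 ⟨Finset.mem_range.2 (by lia), h hx.2⟩)

lemma dOf_dvd_self {S : Set ℕ} {s : ℕ} (hs : s ∈ S) : dOf S s ∣ s := by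
  classical
  exact Finset.gcd_dvd (f := id) (Finset.mem_filter.2 ⟨Finset.self_mem_range_succ s, hs⟩)

lemma IsSaturatedNS.add_mem_of_dOf_dvd {S : Set ℕ} (hS : IsSaturatedNS S) {s m : ℕ}
    (hs : s ∈ S) (hs0 : s ≠ 0) (hm : dOf S s ∣ m) : s + m ∈ S := by
  induction m using Nat.strong_induction_on generalizing s with
  | _ m ih =>
    rcases Nat.eq_zero_or_pos m with rfl | hpos
    · exact hs
    have hd : 0 < dOf S s := Nat.pos_of_dvd_of_pos (dOf_dvd_self hs) (Nat.pos_of_ne_zero hs0)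
    have hle : dOf S s ≤ m := Nat.le_of_dvd hpos hm
    have key := ih (m - dOf S s) (by lia) (hS.2 s hs hs0) (by lia)
      ((dOf_dvd_of_subset subset_rfl (Nat.le_add_right _ _)).trans (Nat.dvd_sub hm dvd_rfl))
    rwa [add_assoc, Nat.add_sub_cancel' hle] at key

lemma IsNumericalSemigroup.inter {S T : Set ℕ} (hS : IsNumericalSemigroup S)
    (hT : IsNumericalSemigroup T) : IsNumericalSemigroup (S ∩ T) := by
  refine ⟨⟨hS.1, hT.1⟩, fun a ha b hb => ⟨hS.2.1 a ha.1 b hb.1, hT.2.1 a ha.2 b hb.2⟩, ?_⟩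
  rw [Set.compl_inter]
  exact hS.2.2.union hT.2.2

/-- the intersection of two saturated numerical semigroups is a
saturated numerical semigroup. -/
theorem inter_of_saturated (S T : Set ℕ)
    (hS : IsSaturatedNS S) (hT : IsSaturatedNS T) :
    IsSaturatedNS (S ∩ T) :=
  ⟨hS.1.inter hT.1, fun _ hs hs0 =>
    ⟨hS.add_mem_of_dOf_dvd hs.1 hs0 (dOf_dvd_of_subset Set.inter_subset_left le_rfl),
      hT.add_mem_of_dOf_dvd hs.2 hs0 (dOf_dvd_of_subset Set.inter_subset_right le_rfl)⟩⟩
end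

section
/- Let F be a positive integer and let S ∈ Sat(F). For a subset T of ℕ, the following are equivalent: (1) T ∈ Sat(F) and T \ {m(T)} = S; (2) T = S ∪ {x} for some x ∈ SG(S) with x < m(S) and S ∪ {x} ∈ Sat(F). Here m denotes multiplicity and SG the set of special gaps. -/
theorem multOf_mem_of_mem_SatF {F : ℕ} {S : Set ℕ} (hS : S ∈ SatF F) :
    multOf S ∈ S ∧ multOf S ≠ 0 := by
  refine Nat.sInf_mem (s := {x | x ∈ S ∧ x ≠ 0}) ⟨F + 1, ?_, F.succ_ne_zero⟩
  by_contra h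
  exact absurd (hS.2.2 _ h) (by omega)

theorem multOf_le {S : Set ℕ} {x : ℕ} (hx : x ∈ S) (hx0 : x ≠ 0) : multOf S ≤ x :=
  Nat.sInf_le ⟨hx, hx0⟩

theorem multOf_union_singleton {F : ℕ} {S : Set ℕ} {x : ℕ} (hT : S ∪ {x} ∈ SatF F)
    (hx0 : x ≠ 0) (hx : x < multOf S) : multOf (S ∪ {x}) = x := by
  obtain ⟨h | h, h0⟩ := multOf_mem_of_mem_SatF hT
  · have h₁ := multOf_le h h0
    have h₂ : multOf (S ∪ {x}) ≤ x := multOf_le (Or.inr rfl) hx0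
    omega
  · exact h

/-- characterization of the children of `S` in the tree `G(F)`. -/
theorem children_characterization (F : ℕ) (hF : 0 < F)
    (S : Set ℕ) (hS : S ∈ SatF F) (T : Set ℕ) :
    (T ∈ SatF F ∧ T \ {multOf T} = S) ↔
      (∃ x ∈ SGset S, x < multOf S ∧ T = S ∪ {x} ∧ S ∪ {x} ∈ SatF F) := by
  constructor
  · rintro ⟨hT, hTS⟩
    obtain ⟨hm, hm0⟩ := multOf_mem_of_mem_SatF hT
    have hmem : ∀ y, y ∈ S ↔ y ∈ T ∧ y ≠ multOf T := fun y => by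
      rw [← hTS, Set.mem_sdiff, Set.mem_singleton_iff]
    have hadd := hT.1.1.2.1
    have hunion : T = S ∪ {multOf T} := by
      rw [← hTS, Set.sdiff_union_of_subset (Set.singleton_subset_iff.2 hm)]
    refine ⟨multOf T, ⟨⟨fun h => ((hmem _).1 h).2 rfl, fun s hs hs0 => ?_⟩, ?_⟩, ?_,
      hunion, hunion ▸ hT⟩
    · exact (hmem _).2 ⟨hadd _ hm _ ((hmem s).1 hs).1, by omega⟩
    · exact (hmem _).2 ⟨two_mul (multOf T) ▸ hadd _ hm _ hm, by omega⟩
    · obtain ⟨hn, hn0⟩ := multOf_mem_of_mem_SatF hS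
      obtain ⟨hnT, hne⟩ := (hmem _).1 hn
      exact lt_of_le_of_ne (multOf_le hnT hn0) hne.symm
  · rintro ⟨x, hx, hlt, rfl, hT⟩
    have hxS : x ∉ S := hx.1.1
    have hx0 : x ≠ 0 := fun h => hxS (h ▸ hS.1.1.1)
    refine ⟨hT, ?_⟩
    rw [multOf_union_singleton hT hx0 hlt, Set.union_sdiff_right,
      Set.sdiff_singleton_eq_self hxS]
end

section
/- Let F be a positive integer, S ∈ Sat(F), and x ∈ SG(S) with x < m(S) and x ≠ F. Then S ∪ {x} ∈ Sat(F) if and only if s + d_{S∪{x}}(s) ∈ S for every s ∈ S with m(S) ≤ s ≤ m(S) + x. -/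
theorem dvd_dOf_iff {S : Set ℕ} {s k : ℕ} : k ∣ dOf S s ↔ ∀ a ∈ S, a ≤ s → k ∣ a := by
  simp only [dOf, Finset.dvd_gcd_iff, Finset.mem_filter, Finset.mem_range, id, Nat.lt_succ_iff]
  exact ⟨fun h a ha has => h a ⟨has, ha⟩, fun h a ha => h a ha.2 ha.1⟩

theorem dOf_dvd {S : Set ℕ} {s a : ℕ} (ha : a ∈ S) (has : a ≤ s) : dOf S s ∣ a :=
  dvd_dOf_iff.1 dvd_rfl a ha has

theorem multOf_le_s3 {S : Set ℕ} {s : ℕ} (hs : s ∈ S) (hs0 : s ≠ 0) : multOf S ≤ s :=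
  Nat.sInf_le ⟨hs, hs0⟩

theorem multOf_mem {S : Set ℕ} (h : 0 < multOf S) : multOf S ∈ S :=
  (Nat.sInf_mem (Nat.nonempty_of_pos_sInf h)).1

/-- Below the multiplicity, the only nonzero element of `S ∪ {x}` is `x`. -/
theorem dOf_union_singleton_self {S : Set ℕ} {x : ℕ} (hxm : x < multOf S) :
    dOf (S ∪ {x}) x = x := by
  refine Nat.dvd_antisymm (dOf_dvd (Or.inr rfl) le_rfl) (dvd_dOf_iff.2 ?_)
  rintro a (ha | rfl) hax
  · by_cases h0 : a = 0
    · exact h0 ▸ dvd_zero x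
    · have := multOf_le_s3 ha h0
      omega
  · exact dvd_rfl

/-- Adjoining `x` does not change the gcd once it divides `x`. -/
theorem dOf_union_singleton_of_dvd {S : Set ℕ} {x s : ℕ} (h : dOf S s ∣ x) :
    dOf (S ∪ {x}) s = dOf S s := by
  refine Nat.dvd_antisymm
    (dvd_dOf_iff.2 fun a ha has => dOf_dvd (Or.inl ha) has) (dvd_dOf_iff.2 ?_)
  rintro a (ha | rfl) has
  · exact dOf_dvd ha has
  · exact h

theorem IsNumericalSemigroup.union_specialGap {S : Set ℕ} (hS : IsNumericalSemigroup S) {x : ℕ}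
    (hx : x ∈ SGset S) : IsNumericalSemigroup (S ∪ {x}) := by
  obtain ⟨h0, hadd, hfin⟩ := hS
  obtain ⟨⟨-, hpf⟩, h2x⟩ := hx
  have hxs : ∀ s ∈ S, x + s ∈ S ∪ {x} := fun s hs => by
    by_cases hs0 : s = 0
    · exact Or.inr (by simp [hs0])
    · exact Or.inl (hpf s hs hs0)
  refine ⟨Or.inl h0, ?_, hfin.subset (Set.compl_subset_compl.2 Set.subset_union_left)⟩
  rintro a (ha | rfl) b (hb | rfl)
  · exact Or.inl (hadd a ha b hb)
  · exact add_comm a b ▸ hxs a ha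
  · exact hxs b hb
  · exact Or.inl (two_mul b ▸ h2x)

/-- criterion for `S ∪ {x}` to belong to `Sat(F)`. -/
theorem union_special_gap_mem_SatF_iff (F : ℕ) (hF : 0 < F)
    (S : Set ℕ) (hS : S ∈ SatF F) (x : ℕ) (hx : x ∈ SGset S)
    (hxm : x < multOf S) (hxF : x ≠ F) :
    S ∪ {x} ∈ SatF F ↔
      ∀ s ∈ S, multOf S ≤ s → s ≤ multOf S + x → s + dOf (S ∪ {x}) s ∈ S := by
  obtain ⟨⟨hns, hsat⟩, hFS, hgap⟩ := hS
  have hm : multOf S ∈ S := multOf_mem (by omega)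
  constructor
  · rintro ⟨⟨-, hsat'⟩, -⟩ s hs hms -
    rcases hsat' s (Or.inl hs) (by omega) with h | h
    · exact h
    · have : s + dOf (S ∪ {x}) s = x := h
      omega
  · intro h
    refine ⟨⟨hns.union_specialGap hx, ?_⟩, ?_, fun y hy => hgap y fun hyS => hy (Or.inl hyS)⟩
    · rintro s (hs | rfl) hs0
      · left
        by_cases hsx : s ≤ multOf S + x
        · exact h s hs (multOf_le_s3 hs hs0) hsx
        · have hmx : x + multOf S ∈ S := hx.1.2 _ hm (by omega)
          have hdvd : dOf S s ∣ x :=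
            (Nat.dvd_add_left (dOf_dvd hm (by omega))).1 (dOf_dvd hmx (by omega))
          rw [dOf_union_singleton_of_dvd hdvd]
          exact hsat s hs hs0
      · rw [dOf_union_singleton_self hxm, ← two_mul]
        exact Or.inl hx.2
    · rintro (hF' | hF')
      · exact hFS hF'
      · exact hxF hF'.symm
end

section
/- Let F be a positive integer and S ∈ Sat(F). For every integer g with g(S) ≤ g ≤ F, there exists T ∈ Sat(F) with genus g(T) = g. -/
theorem dOf_dvd_of_mem {S : Set ℕ} {s x : ℕ} (hx : x ∈ S) (hxs : x ≤ s) : dOf S s ∣ x := by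
  classical
  unfold dOf
  exact Finset.gcd_dvd (f := id)
    (Finset.mem_filter.2 ⟨Finset.mem_range.2 (Nat.lt_succ_of_le hxs), hx⟩)

theorem dvd_dOf {S : Set ℕ} {s d : ℕ} (h : ∀ x ∈ S, x ≤ s → d ∣ x) : d ∣ dOf S s := by
  classical
  unfold dOf
  refine Finset.dvd_gcd fun x hx => ?_
  rw [Finset.mem_filter, Finset.mem_range] at hx
  exact h x hx.2 (Nat.le_of_lt_succ hx.1)

/-- A saturated numerical semigroup contains every multiple of `dOf S s` that is at least `s`. -/
theorem IsSaturatedNS.mem_of_dOf_dvd {S : Set ℕ} (hS : IsSaturatedNS S) {s t : ℕ}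
    (hs : s ∈ S) (hs0 : s ≠ 0) (hst : s ≤ t) (hd : dOf S s ∣ t) : t ∈ S := by
  induction hn : t - s using Nat.strong_induction_on generalizing s with
  | _ n ih =>
    obtain rfl | hlt := hst.eq_or_lt
    · exact hs
    have hds : dOf S s ∣ s := dOf_dvd_of_mem hs le_rfl
    have hpos : 0 < dOf S s := Nat.pos_of_dvd_of_pos hds (Nat.pos_of_ne_zero hs0)
    have hle : dOf S s ≤ t - s := Nat.le_of_dvd (by omega) (Nat.dvd_sub hd hds)
    refine ih (t - (s + dOf S s)) (by omega) (hS.2 s hs hs0) (by omega) (by omega) ?_ rfl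
    exact (dvd_dOf fun x hx hxs => dOf_dvd_of_mem hx (by omega)).trans hd

/-- Removing the multiplicity from a saturated numerical semigroup leaves a saturated one. -/
theorem IsSaturatedNS.diff_multiplicity {S : Set ℕ} (hS : IsSaturatedNS S) {m : ℕ}
    (hm0 : m ≠ 0) (hmin : ∀ x ∈ S, x ≠ 0 → m ≤ x) : IsSaturatedNS (S \ {m}) := by
  refine ⟨⟨⟨hS.1.1, by simpa using hm0.symm⟩, ?_, ?_⟩, ?_⟩
  · rintro a ⟨ha, ham⟩ b ⟨hb, hbm⟩
    refine ⟨hS.1.2.1 a ha b hb, ?_⟩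
    have hma := hmin a ha
    have hmb := hmin b hb
    simp only [Set.mem_singleton_iff] at ham hbm ⊢
    omega
  · rw [Set.compl_sdiff]
    exact (Set.finite_singleton m).union hS.1.2.2
  · rintro s ⟨hs, hsm⟩ hs0
    have hdvd : dOf S s ∣ dOf (S \ {m}) s :=
      dvd_dOf fun x hx hxs => dOf_dvd_of_mem hx.1 hxs
    refine ⟨hS.mem_of_dOf_dvd hs hs0 (by omega)
      (dvd_add (dOf_dvd_of_mem hs le_rfl) hdvd), ?_⟩
    have hms := hmin s hs hs0
    simp only [Set.mem_singleton_iff] at hsm ⊢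
    omega

/-- If the genus is less than the Frobenius number, some nonzero element is at most it. -/
theorem exists_mem_le_of_ncard_compl_lt {S : Set ℕ} {F : ℕ} (hfin : Sᶜ.Finite)
    (h : Sᶜ.ncard < F) : ∃ x ∈ S, x ≠ 0 ∧ x ≤ F := by
  by_contra! hno
  have hsub : (Finset.Icc 1 F : Set ℕ) ⊆ Sᶜ := by
    intro x hx hxS
    rw [Finset.coe_Icc, Set.mem_Icc] at hx
    have := hno x hxS (by omega)
    omega
  have hcard := Set.ncard_le_ncard hsub hfin
  rw [Set.ncard_coe_finset, Nat.card_Icc] at hcard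
  omega

theorem exists_mem_SatF_of_ncard_compl_succ {F : ℕ} {S : Set ℕ} (hS : S ∈ SatF F)
    (h : Sᶜ.ncard < F) : ∃ T ∈ SatF F, Tᶜ.ncard = Sᶜ.ncard + 1 := by
  classical
  obtain ⟨hsat, hF, hle⟩ := hS
  have hex := exists_mem_le_of_ncard_compl_lt hsat.1.2.2 h
  obtain ⟨hmS, hm0, hmF⟩ := Nat.find_spec hex
  have hmin : ∀ x ∈ S, x ≠ 0 → Nat.find hex ≤ x := by
    intro x hx hx0
    by_contra hlt
    exact hlt (Nat.find_min' hex ⟨hx, hx0, by omega⟩)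
  generalize Nat.find hex = m at hmS hm0 hmF hmin
  refine ⟨S \ {m}, ⟨hsat.diff_multiplicity hm0 hmin, fun hFm => hF hFm.1, ?_⟩, ?_⟩
  · intro x hx
    by_cases hxm : x = m
    · exact hxm ▸ hmF
    · exact hle x fun hxS => hx ⟨hxS, hxm⟩
  · rw [Set.compl_sdiff, Set.singleton_union]
    exact Set.ncard_insert_of_notMem (by simpa using hmS) hsat.1.2.2

/-- every genus between `g(S)` and `F` is attained in `Sat(F)`. -/
theorem exists_mem_SatF_of_genus_between (F : ℕ) (hF : 0 < F)
    (S : Set ℕ) (hS : S ∈ SatF F) (g : ℕ)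
    (hg1 : Sᶜ.ncard ≤ g) (hg2 : g ≤ F) :
    ∃ T ∈ SatF F, Tᶜ.ncard = g := by
  induction g, hg1 using Nat.le_induction with
  | base => exact ⟨S, hS, rfl⟩
  | succ k _ ih =>
    obtain ⟨T, hT, rfl⟩ := ih (by omega)
    exact exists_mem_SatF_of_ncard_compl_succ hT hg2
end
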